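/- Let H be a finite group such that for any g, x ∈ H there is a positive integer n₀ with [[g,_n x], g] = 1 for all n ≥ n₀. Then H is nilpotent. -/

import Mathlib

/-- The commutator `[a,b] = a⁻¹ b⁻¹ a b`. -/
def cmtr {G : Type*} [Group G] (a b : G) : G := a⁻¹ * b⁻¹ * a * b

/-- `engel a b n` is the left-normed Engel commutator `[a,_n b] = [[...[[a,b],b],...],b]`
with `b` repeated `n` times. -/
def engel {G : Type*} [Group G] (a b : G) : ℕ → G
  | 0 => a
  | n + 1 => cmtr (engel a b n) b

/-- A finite subset `R` of `G` is a right Engel sink for `g` if for every `x ∈ G` there is a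
positive integer `n₀` such that `[g,_n x] ∈ R` for all `n ≥ n₀`. -/
def IsRightEngelSink {G : Type*} [Group G] (g : G) (R : Set G) : Prop :=
  R.Finite ∧ ∀ x : G, ∃ n₀ : ℕ, 0 < n₀ ∧ ∀ n ≥ n₀, engel g x n ∈ R

/-- A finite subset `E` of `G` is a left Engel sink for `g` if for every `x ∈ G` there is a
positive integer `n₀` such that `[x,_n g] ∈ E` for all `n ≥ n₀`. -/
def IsLeftEngelSink {G : Type*} [Group G] (g : G) (E : Set G) : Prop :=
  E.Finite ∧ ∀ x : G, ∃ n₀ : ℕ, 0 < n₀ ∧ ∀ n ≥ n₀, engel x g n ∈ E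

/-- An element is almost right Engel if it admits a finite right Engel sink. -/
def AlmostRightEngel {G : Type*} [Group G] (g : G) : Prop :=
  ∃ R : Set G, IsRightEngelSink g R

/-- A group is locally nilpotent if every finitely generated subgroup is nilpotent. -/
def LocallyNilpotent (G : Type*) [Group G] : Prop :=
  ∀ H : Subgroup G, H.FG → Group.IsNilpotent H

theorem map_cmtr {G K : Type*} [Group G] [Group K] (f : G →* K) (a b : G) :
    f (cmtr a b) = cmtr (f a) (f b) := by
  simp [cmtr]

theorem map_engel {G K : Type*} [Group G] [Group K] (f : G →* K) (a b : G) (n : ℕ) :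
    f (engel a b n) = engel (f a) (f b) n := by
  induction n with
  | zero => rfl
  | succ n ih => rw [engel, engel, map_cmtr, ih]

theorem cmtr_eq_one_iff {G : Type*} [Group G] {a b : G} : cmtr a b = 1 ↔ a * b = b * a := by
  rw [cmtr, ← mul_inv_rev, mul_assoc, inv_mul_eq_one, eq_comm]

theorem engel_mul_left_succ {G : Type*} [Group G] (g x : G) (n : ℕ) :
    engel (x * g) x (n + 1) = engel g x (n + 1) := by
  induction n with
  | zero => simp [engel, cmtr, mul_assoc]
  | succ n ih => rw [engel, ih, ← engel]

theorem exists_mem_normalizer_of_lt {G : Type*} [Group G] {D M : Subgroup G}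
    [Group.IsNilpotent M] (hDM : D < M) :
    ∃ y ∈ M, y ∉ D ∧ y ∈ Subgroup.normalizer (D : Set G) := by
  have hlt : D.subgroupOf M < ⊤ :=
    lt_top_iff_ne_top.mpr fun h => hDM.not_ge (Subgroup.subgroupOf_eq_top.mp h)
  obtain ⟨y, hy, hyD⟩ := SetLike.exists_of_lt
    (Group.normalizerCondition_of_isNilpotent (G := M) _ hlt)
  refine ⟨y, y.2, fun h => hyD (Subgroup.mem_subgroupOf.mpr h), ?_⟩
  have key : ∀ z ∈ D, ∀ w ∈ Subgroup.normalizer (D.subgroupOf M : Set M),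
      (w : G) * z * (w : G)⁻¹ ∈ D := fun z hz w hw => by
    simpa [Subgroup.mem_subgroupOf] using
      (Subgroup.mem_normalizer_iff.mp hw ⟨z, hDM.le hz⟩).mp (Subgroup.mem_subgroupOf.mpr hz)
  refine Subgroup.mem_normalizer_iff.mpr fun z => ⟨fun hz => key z hz y hy, fun hz => ?_⟩
  simpa [mul_assoc] using key _ hz y⁻¹ (inv_mem hy)

theorem isCoatom_map_of_ker_le {G K : Type*} [Group G] [Group K] {f : G →* K}
    (hf : Function.Surjective f) {M : Subgroup G} (hM : IsCoatom M) (hker : f.ker ≤ M) :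
    IsCoatom (M.map f) := by
  have hcomap : (M.map f).comap f = M := Subgroup.comap_map_eq_self hker
  refine ⟨fun h => hM.1 ?_, fun L hL => ?_⟩
  · rw [← hcomap, h, Subgroup.comap_top]
  · have hlt : M < L.comap f := hcomap ▸ (Subgroup.comap_lt_comap_of_surjective hf).mpr hL
    rw [← Subgroup.map_comap_eq_self_of_surjective hf L, hM.2 _ hlt,
      Subgroup.map_top_of_surjective f hf]

/-- In a group satisfying the Engel condition, every nontrivial element of a self-normalizing
subgroup lies in a different conjugate of that subgroup. -/
theorem exists_conj_mem_of_engel {G : Type*} [Group G] {M : Subgroup G}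
    (hM : Subgroup.normalizer (M : Set G) = M) (hM_top : M ≠ ⊤) {a : G} (ha : a ∈ M)
    (h : ∀ g : G, ∃ n, engel g a n = 1) :
    ∃ c : G, a ∈ M.comap (MulAut.conj c).toMonoidHom ∧
      M.comap (MulAut.conj c).toMonoidHom ≠ M := by
  obtain ⟨g, hg⟩ : ∃ g, g ∉ M := by
    by_contra! hall
    exact hM_top (Subgroup.eq_top_iff' M |>.mpr hall)
  obtain ⟨k, hk, hk'⟩ : ∃ k, engel g a k ∉ M ∧ engel g a (k + 1) ∈ M := by
    by_contra! hstep
    obtain ⟨n, hn⟩ := h g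
    replace hn : engel g a n ∈ M := hn ▸ M.one_mem
    induction n with
    | zero => exact hg hn
    | succ n ih => exact hstep n ih hn
  set c := engel g a k
  refine ⟨c⁻¹, ?_, fun heq => hk ?_⟩
  · have := M.inv_mem (M.mul_mem hk' (M.inv_mem ha))
    simpa [engel, cmtr, mul_assoc] using this
  · rw [← inv_mem_iff, ← hM, Subgroup.mem_normalizer_iff]
    intro z
    conv_lhs => rw [← heq]
    simp

/-- Zorn's theorem: finite Engel groups are nilpotent. -/
theorem isNilpotent_of_finite_of_engel {G : Type*} [Group G] [Finite G]
    (h : ∀ g x : G, ∃ n, engel g x n = 1) : Group.IsNilpotent G := by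
  induction hcard : Nat.card G using Nat.strong_induction_on generalizing G with
  | _ m ih =>
  subst hcard
  have hsub : ∀ M : Subgroup G, M ≠ ⊤ → Group.IsNilpotent M := fun M hM => by
    refine ih (Nat.card M) (lt_of_le_of_ne M.card_le_card_group fun he =>
      hM (M.eq_top_of_card_eq he)) (fun g x => ?_) rfl
    obtain ⟨n, hn⟩ := h g x
    exact ⟨n, Subtype.ext ((map_engel M.subtype g x n).trans hn)⟩
  have hquot : ∀ D : Subgroup G, [D.Normal] → D ≠ ⊥ → Group.IsNilpotent (G ⧸ D) :=
      fun D _ hD => by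
    refine ih (Nat.card (G ⧸ D)) ?_ (fun g x => ?_) rfl
    · rw [D.card_eq_card_quotient_mul_card_subgroup]
      exact lt_mul_of_one_lt_right Nat.card_pos ((Subgroup.one_lt_card_iff_ne_bot D).mpr hD)
    · obtain ⟨g, rfl⟩ := QuotientGroup.mk'_surjective D g
      obtain ⟨x, rfl⟩ := QuotientGroup.mk'_surjective D x
      obtain ⟨n, hn⟩ := h g x
      exact ⟨n, by rw [← map_engel, hn, map_one]⟩
  refine (Group.isNilpotent_of_finite_tfae (G := G).out 0 2).mpr fun M hM => ?_
  by_contra hMn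
  have hself : Subgroup.normalizer (M : Set G) = M :=
    ((hM.le_iff.mp Subgroup.le_normalizer).resolve_left
      fun ht => hMn (Subgroup.normalizer_eq_top_iff.mp ht))
  have hMbot : M ≠ ⊥ := by
    rintro rfl
    exact hMn inferInstance
  obtain ⟨a, haM, ha⟩ := M.bot_or_exists_ne_one.resolve_left hMbot
  obtain ⟨c, hac, hcM⟩ := exists_conj_mem_of_engel hself hM.1 haM fun g => h g a
  obtain ⟨N, ⟨hN, hNM⟩, hmax⟩ := Set.exists_max_image
    {N : Subgroup G | IsCoatom N ∧ N ≠ M} (fun N => Nat.card (M ⊓ N : Subgroup G))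
    (Set.toFinite _) ⟨_, Subgroup.isCoatom_comap (MulAut.conj c) |>.mpr hM, hcM⟩
  set D := M ⊓ N
  have hDM : D < M := inf_le_left.lt_of_ne fun he =>
    hNM ((hM.le_iff.mp (inf_eq_left.mp he)).resolve_left hN.1)
  have hDN : D < N := inf_le_right.lt_of_ne fun he =>
    hNM ((hN.le_iff.mp (inf_eq_right.mp he)).resolve_left hM.1).symm
  have hDbot : D ≠ ⊥ := by
    have hle := hmax _ ⟨Subgroup.isCoatom_comap (MulAut.conj c) |>.mpr hM, hcM⟩
    refine (Subgroup.one_lt_card_iff_ne_bot D).mp (lt_of_lt_of_le ?_ hle)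
    exact (Subgroup.one_lt_card_iff_ne_bot _).mpr fun hbot =>
      ha (Subgroup.mem_bot.mp (hbot ▸ Subgroup.mem_inf.mpr ⟨haM, hac⟩))
  have hDnormal : D.Normal := by
    rw [← Subgroup.normalizer_eq_top_iff]
    by_contra hne
    obtain ⟨L, hL, hDL⟩ := (eq_top_or_exists_le_coatom _).resolve_left hne
    have := hsub M hM.1
    have := hsub N hN.1
    obtain ⟨y, hyM, hyD, hy⟩ := exists_mem_normalizer_of_lt hDM
    obtain ⟨z, hzN, hzD, hz⟩ := exists_mem_normalizer_of_lt hDN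
    have hLM : L = M := by
      by_contra hLM
      have hlt : D < M ⊓ L := SetLike.lt_iff_le_and_exists.mpr
        ⟨le_inf inf_le_left (Subgroup.le_normalizer.trans hDL), y, Subgroup.mem_inf.mpr ⟨hyM, hDL hy⟩, hyD⟩
      exact (hmax L ⟨hL, hLM⟩).not_gt (Set.ncard_lt_ncard hlt)
    exact hzD ⟨hLM ▸ hDL hz, hzN⟩
  have := hquot D hDbot
  have hker : (QuotientGroup.mk' D).ker ≤ M := (QuotientGroup.ker_mk' D).trans_le inf_le_left
  have := Subgroup.NormalizerCondition.normal_of_coatom _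
    Group.normalizerCondition_of_isNilpotent
    (isCoatom_map_of_ker_le (QuotientGroup.mk'_surjective D) hM hker)
  exact hMn (Subgroup.comap_map_eq_self hker ▸ this.comap (QuotientGroup.mk' D))


/-- A finite group in which for all `g, x` all sufficiently long Engel commutators
`[g,_n x]` commute with `g` is nilpotent. -/
theorem finite_sandwich_nilpotent {H : Type*} [Group H] [Finite H]
    (h : ∀ g x : H, ∃ n₀ : ℕ, 0 < n₀ ∧ ∀ n ≥ n₀, cmtr (engel g x n) g = 1) :
    Group.IsNilpotent H := by
  refine isNilpotent_of_finite_of_engel fun g x => ?_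
  obtain ⟨m, -, hm⟩ := h g x
  obtain ⟨n, -, hn⟩ := h (x * g) x
  have hg := cmtr_eq_one_iff.mp (hm (m + n + 1) (by omega))
  have hxg := cmtr_eq_one_iff.mp (hn (m + n + 1) (by omega))
  rw [engel_mul_left_succ] at hxg
  refine ⟨m + n + 2, cmtr_eq_one_iff.mpr (mul_right_cancel (b := g) ?_)⟩
  rw [mul_assoc, hxg, mul_assoc, mul_assoc, hg]
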